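/- arXiv:2501.14591 — 3 statements merged into one kernel-verified Lean document; each statement's English description precedes it below -/
import Mathlib

section
/- The metric average satisfies the metric property: for nonempty compact sets A, B ⊆ ℝ^d and any weight w ∈ [0,1], d_H(A ⊕_w B, A) ≤ d_H(A,B) and d_H(A ⊕_w B, B) ≤ d_H(A,B). -/
open Metric Set

/-- `Π(A,B) = {(a,b) ∈ A×B : ‖a−b‖ = dist(a,B) or ‖a−b‖ = dist(b,A)}`. -/
def metricPairs (d : ℕ) (A B : Set (EuclideanSpace ℝ (Fin d))) :
    Set (EuclideanSpace ℝ (Fin d) × EuclideanSpace ℝ (Fin d)) :=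
  {p | p.1 ∈ A ∧ p.2 ∈ B ∧
    (‖p.1 - p.2‖ = infDist p.1 B ∨ ‖p.1 - p.2‖ = infDist p.2 A)}

/-- The metric average `A ⊕_w B = {(1−w)a + w b : (a,b) ∈ Π(A,B)}`. -/
def metricAverage (d : ℕ) (A B : Set (EuclideanSpace ℝ (Fin d))) (w : ℝ) :
    Set (EuclideanSpace ℝ (Fin d)) :=
  (fun p : EuclideanSpace ℝ (Fin d) × EuclideanSpace ℝ (Fin d) =>
    (1 - w) • p.1 + w • p.2) '' metricPairs d A B

/-- Points of a metric pair are at distance at most the Hausdorff distance. -/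
theorem norm_sub_le_hausdorffDist_of_mem_metricPairs {d : ℕ}
    {A B : Set (EuclideanSpace ℝ (Fin d))} (hfin : hausdorffEDist A B ≠ ⊤)
    {p : EuclideanSpace ℝ (Fin d) × EuclideanSpace ℝ (Fin d)}
    (hp : p ∈ metricPairs d A B) : ‖p.1 - p.2‖ ≤ hausdorffDist A B := by
  obtain ⟨ha, hb, h | h⟩ := hp
  · rw [h]
    exact infDist_le_hausdorffDist_of_mem ha hfin
  · rw [h, hausdorffDist_comm]
    exact infDist_le_hausdorffDist_of_mem hb (by rwa [hausdorffEDist_comm])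

/-- Every point of `A` is the first component of a metric pair. -/
theorem exists_mem_metricPairs_left {d : ℕ} {A B : Set (EuclideanSpace ℝ (Fin d))}
    (hB : B.Nonempty) (hBc : IsCompact B) {a : EuclideanSpace ℝ (Fin d)} (ha : a ∈ A) :
    ∃ b, (a, b) ∈ metricPairs d A B := by
  obtain ⟨b, hb, h⟩ := hBc.exists_infDist_eq_dist hB a
  exact ⟨b, ha, hb, Or.inl (by rw [h, dist_eq_norm])⟩

/-- Every point of `B` is the second component of a metric pair. -/
theorem exists_mem_metricPairs_right {d : ℕ} {A B : Set (EuclideanSpace ℝ (Fin d))}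
    (hA : A.Nonempty) (hAc : IsCompact A) {b : EuclideanSpace ℝ (Fin d)} (hb : b ∈ B) :
    ∃ a, (a, b) ∈ metricPairs d A B := by
  obtain ⟨a, ha, h⟩ := hAc.exists_infDist_eq_dist hA b
  exact ⟨a, ha, hb, Or.inr (by rw [h, dist_comm, dist_eq_norm])⟩

theorem metricAverage_metric_property
    (d : ℕ) (A B : Set (EuclideanSpace ℝ (Fin d)))
    (hA : A.Nonempty) (hAc : IsCompact A)
    (hB : B.Nonempty) (hBc : IsCompact B)
    (w : ℝ) (hw : w ∈ Icc (0 : ℝ) 1) :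
    hausdorffDist (metricAverage d A B w) A ≤ hausdorffDist A B ∧
      hausdorffDist (metricAverage d A B w) B ≤ hausdorffDist A B := by
  have hfin : hausdorffEDist A B ≠ ⊤ :=
    hausdorffEDist_ne_top_of_nonempty_of_bounded hA hB hAc.isBounded hBc.isBounded
  have dist_left : ∀ p ∈ metricPairs d A B,
      dist ((1 - w) • p.1 + w • p.2) p.1 ≤ hausdorffDist A B := by
    intro p hp
    have h : (1 - w) • p.1 + w • p.2 - p.1 = (-w) • (p.1 - p.2) := by module
    rw [dist_eq_norm, h, norm_smul, norm_neg, Real.norm_of_nonneg hw.1]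
    exact (mul_le_of_le_one_left (norm_nonneg _) hw.2).trans
      (norm_sub_le_hausdorffDist_of_mem_metricPairs hfin hp)
  have dist_right : ∀ p ∈ metricPairs d A B,
      dist ((1 - w) • p.1 + w • p.2) p.2 ≤ hausdorffDist A B := by
    intro p hp
    have h : (1 - w) • p.1 + w • p.2 - p.2 = (1 - w) • (p.1 - p.2) := by module
    rw [dist_eq_norm, h, norm_smul, Real.norm_of_nonneg (sub_nonneg.2 hw.2)]
    exact (mul_le_of_le_one_left (norm_nonneg _) (sub_le_self 1 hw.1)).trans
      (norm_sub_le_hausdorffDist_of_mem_metricPairs hfin hp)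
  constructor
  · refine hausdorffDist_le_of_mem_dist hausdorffDist_nonneg ?_ ?_
    · rintro _ ⟨p, hp, rfl⟩
      exact ⟨p.1, hp.1, dist_left p hp⟩
    · intro a ha
      obtain ⟨b, hp⟩ := exists_mem_metricPairs_left hB hBc ha
      exact ⟨_, ⟨(a, b), hp, rfl⟩, (dist_comm _ _).trans_le (dist_left _ hp)⟩
  · refine hausdorffDist_le_of_mem_dist hausdorffDist_nonneg ?_ ?_
    · rintro _ ⟨p, hp, rfl⟩
      exact ⟨p.2, hp.2.1, dist_right p hp⟩
    · intro b hb
      obtain ⟨a, hp⟩ := exists_mem_metricPairs_right hA hAc hb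
      exact ⟨_, ⟨(a, b), hp, rfl⟩, (dist_comm _ _).trans_le (dist_right _ hp)⟩
end

section
/- Let F : [0,1] → K(ℝ^d) be L-Lipschitz in the Hausdorff metric, let δ > 0 with J·δ = 1, and set τ_j = j·δ for j = 0,…,J. Suppose sets Ã_j ∈ K(ℝ^d) satisfy d_H(Ã_j, F(τ_j)) ≤ ε for all j. Define F̃(τ_j) = Ã_j and, for t ∈ (τ_j, τ_{j+1}), F̃(t) = Ã_j ⊕_w Ã_{j+1} with w = (t−τ_j)/δ. Then for every t ∈ [0,1], d_H(F̃(t), F(t)) ≤ 3ε + 2Lδ. -/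
open Metric Set

theorem dist_le_hausdorffDist_of_mem_metricPairs {d : ℕ} {A B : Set (EuclideanSpace ℝ (Fin d))}
    (hAB : hausdorffEDist A B ≠ ⊤) {p : EuclideanSpace ℝ (Fin d) × EuclideanSpace ℝ (Fin d)}
    (hp : p ∈ metricPairs d A B) : dist p.1 p.2 ≤ hausdorffDist A B := by
  obtain ⟨ha, hb, h | h⟩ := hp
  · rw [dist_eq_norm, h]
    exact infDist_le_hausdorffDist_of_mem ha hAB
  · rw [dist_eq_norm, h, hausdorffDist_comm]
    exact infDist_le_hausdorffDist_of_mem hb (by rwa [hausdorffEDist_comm])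

theorem hausdorffDist_metricAverage_left_le {d : ℕ} {A B : Set (EuclideanSpace ℝ (Fin d))}
    (hAB : hausdorffEDist A B ≠ ⊤) (hBne : B.Nonempty) (hB : IsCompact B) {w : ℝ}
    (hw : w ∈ Icc (0 : ℝ) 1) :
    hausdorffDist (metricAverage d A B w) A ≤ hausdorffDist A B := by
  have key : ∀ p ∈ metricPairs d A B,
      dist ((1 - w) • p.1 + w • p.2) p.1 ≤ hausdorffDist A B := by
    intro p hp
    have h := dist_le_hausdorffDist_of_mem_metricPairs hAB hp
    have e : (1 - w) • p.1 + w • p.2 - p.1 = w • (p.2 - p.1) := by module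
    rw [dist_eq_norm, e, norm_smul, Real.norm_of_nonneg hw.1, ← dist_eq_norm, dist_comm]
    exact (mul_le_of_le_one_left dist_nonneg hw.2).trans h
  refine hausdorffDist_le_of_mem_dist hausdorffDist_nonneg ?_ ?_
  · rintro _ ⟨p, hp, rfl⟩
    exact ⟨p.1, hp.1, key p hp⟩
  · intro a ha
    obtain ⟨b, hb, hab⟩ := hB.exists_infDist_eq_dist hBne a
    have hp : (a, b) ∈ metricPairs d A B :=
      ⟨ha, hb, Or.inl (by rw [← dist_eq_norm]; exact hab.symm)⟩
    exact ⟨_, ⟨(a, b), hp, rfl⟩, by rw [dist_comm]; exact key (a, b) hp⟩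

theorem metricAverage_piecewise_interpolation_error
    (d : ℕ) (F : ℝ → Set (EuclideanSpace ℝ (Fin d)))
    (hFne : ∀ t ∈ Icc (0 : ℝ) 1, (F t).Nonempty ∧ IsCompact (F t))
    (L : ℝ)
    (hLip : ∀ t₁ ∈ Icc (0 : ℝ) 1, ∀ t₂ ∈ Icc (0 : ℝ) 1,
      hausdorffDist (F t₁) (F t₂) ≤ L * |t₁ - t₂|)
    (δ : ℝ) (hδ : 0 < δ) (J : ℕ) (hJδ : (J : ℝ) * δ = 1)
    (A : ℕ → Set (EuclideanSpace ℝ (Fin d)))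
    (hAne : ∀ j ≤ J, (A j).Nonempty ∧ IsCompact (A j))
    (ε : ℝ)
    (hAF : ∀ j ≤ J, hausdorffDist (A j) (F ((j : ℝ) * δ)) ≤ ε)
    (Ftil : ℝ → Set (EuclideanSpace ℝ (Fin d)))
    (hFtilNode : ∀ j ≤ J, Ftil ((j : ℝ) * δ) = A j)
    (hFtilMid : ∀ j < J, ∀ t ∈ Ioo ((j : ℝ) * δ) (((j : ℝ) + 1) * δ),
      Ftil t = metricAverage d (A j) (A (j + 1)) ((t - (j : ℝ) * δ) / δ)) :
    ∀ t ∈ Icc (0 : ℝ) 1, hausdorffDist (Ftil t) (F t) ≤ 3 * ε + 2 * L * δ := by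
  have fin : ∀ {S T : Set (EuclideanSpace ℝ (Fin d))}, S.Nonempty ∧ IsCompact S →
      T.Nonempty ∧ IsCompact T → hausdorffEDist S T ≠ ⊤ := fun hS hT =>
    hausdorffEDist_ne_top_of_nonempty_of_bounded hS.1 hT.1 hS.2.isBounded hT.2.isBounded
  have hL : 0 ≤ L := by
    have h := hausdorffDist_nonneg.trans
      (hLip 0 (left_mem_Icc.2 zero_le_one) 1 (right_mem_Icc.2 zero_le_one))
    simpa using h
  have hLδ : 0 ≤ L * δ := mul_nonneg hL hδ.le
  have hε : 0 ≤ ε := hausdorffDist_nonneg.trans (hAF 0 J.zero_le)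
  have hnode : ∀ j ≤ J, (j : ℝ) * δ ∈ Icc (0 : ℝ) 1 := by
    intro j hj
    refine ⟨by positivity, ?_⟩
    rw [← hJδ]
    gcongr
  intro t ht
  have hfloor : (⌊t / δ⌋₊ : ℝ) * δ ≤ t :=
    (le_div_iff₀ hδ).1 (Nat.floor_le (div_nonneg ht.1 hδ.le))
  have hfloor' : t < ((⌊t / δ⌋₊ : ℝ) + 1) * δ :=
    (div_lt_iff₀ hδ).1 (Nat.lt_floor_add_one (t / δ))
  generalize ⌊t / δ⌋₊ = j at hfloor hfloor'
  rcases hfloor.eq_or_lt with heq | hlt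
  · have hj : j ≤ J := by
      have : (j : ℝ) * δ ≤ J * δ := by rw [heq, hJδ]; exact ht.2
      exact_mod_cast le_of_mul_le_mul_right this hδ
    have h := hAF j hj
    rw [← heq, hFtilNode j hj]
    linarith
  · have hj : j < J := by
      have : (j : ℝ) * δ < J * δ := by rw [hJδ]; exact hlt.trans_le ht.2
      exact_mod_cast lt_of_mul_lt_mul_right this hδ.le
    have hw : (t - (j : ℝ) * δ) / δ ∈ Icc (0 : ℝ) 1 :=
      ⟨div_nonneg (by linarith) hδ.le, (div_le_one hδ).2 (by linarith)⟩
    rw [hFtilMid j hj t ⟨hlt, hfloor'⟩]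
    have hA := hAne j hj.le
    have hA' := hAne (j + 1) hj
    have hF := hFne _ (hnode j hj.le)
    have hF' := hFne _ (hnode (j + 1) hj)
    have hstep : hausdorffDist (F ((j : ℝ) * δ)) (F (((j + 1 : ℕ) : ℝ) * δ)) ≤ L * δ := by
      have h := hLip _ (hnode j hj.le) _ (hnode (j + 1) hj)
      have e : (j : ℝ) * δ - ((j + 1 : ℕ) : ℝ) * δ = -δ := by push_cast; ring
      rwa [e, abs_neg, abs_of_pos hδ] at h
    have hlocal : hausdorffDist (F ((j : ℝ) * δ)) (F t) ≤ L * δ := by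
      refine (hLip _ (hnode j hj.le) t ht).trans (mul_le_mul_of_nonneg_left ?_ hL)
      rw [abs_le]
      constructor <;> linarith
    have h₁ := hausdorffDist_metricAverage_left_le (fin hA hA') hA'.1 hA'.2 hw
    have h₂ := hausdorffDist_triangle
      (s := A j) (t := F ((j : ℝ) * δ)) (u := A (j + 1)) (fin hA hF)
    have h₃ := hausdorffDist_triangle
      (s := F ((j : ℝ) * δ)) (t := F (((j + 1 : ℕ) : ℝ) * δ)) (u := A (j + 1)) (fin hF hF')
    have h₄ := hAF (j + 1) hj
    rw [hausdorffDist_comm] at h₄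
    have h₅ := hausdorffDist_triangle
      (s := A j) (t := F ((j : ℝ) * δ)) (u := F t) (fin hA hF)
    have h₆ := hausdorffDist_triangle'
      (s := metricAverage d (A j) (A (j + 1)) ((t - (j : ℝ) * δ) / δ)) (fin hA (hFne t ht))
    have h₇ := hAF j hj.le
    linarith
end

section
/- Let Ω ⊆ ℝ^n and let Γ = ∂Ω (the topological frontier of Ω) be nonempty. Define the signed distance function f : ℝ^n → ℝ by f(x) = dist(x,Γ) if x ∈ Ω and f(x) = −dist(x,Γ) otherwise. Let S : ℝ^n → ℝ be continuous with |S(x) − f(x)| ≤ ε for all x ∈ ℝ^n, and let Z = {x ∈ ℝ^n : S(x) = 0}. Suppose δ > 0 is such that for every p ∈ Γ there exist points a, b in the closed ball of radius δ around p with f(a) > ε and f(b) < −ε. Then Z is nonempty, every z ∈ Z satisfies dist(z,Γ) ≤ ε, every p ∈ Γ satisfies dist(p,Z) ≤ δ, and consequently d_H(Γ, Z) ≤ max(ε, δ). -/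
open Metric Set Classical

open scoped Classical in
theorem zero_level_set_of_approximate_signed_distance
    (n : ℕ) (Ω : Set (EuclideanSpace ℝ (Fin n)))
    (Γ : Set (EuclideanSpace ℝ (Fin n))) (hΓ : Γ = frontier Ω) (hΓne : Γ.Nonempty)
    (f : EuclideanSpace ℝ (Fin n) → ℝ)
    (hf : ∀ x, f x = if x ∈ Ω then infDist x Γ else -infDist x Γ)
    (S : EuclideanSpace ℝ (Fin n) → ℝ) (hS : Continuous S)
    (ε : ℝ) (hSf : ∀ x, |S x - f x| ≤ ε)
    (Z : Set (EuclideanSpace ℝ (Fin n))) (hZ : Z = {x | S x = 0})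
    (δ : ℝ) (hδ : 0 < δ)
    (hcross : ∀ p ∈ Γ, ∃ a ∈ closedBall p δ, ∃ b ∈ closedBall p δ,
      ε < f a ∧ f b < -ε) :
    Z.Nonempty ∧ (∀ z ∈ Z, infDist z Γ ≤ ε) ∧ (∀ p ∈ Γ, infDist p Z ≤ δ) ∧
      hausdorffDist Γ Z ≤ max ε δ := by
  have hzero : ∀ p ∈ Γ, ∃ z ∈ Z, dist p z ≤ δ := by
    intro p hp
    obtain ⟨a, ha, b, hb, hfa, hfb⟩ := hcross p hp
    have hSa : 0 ≤ S a := by linarith [(abs_le.mp (hSf a)).1]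
    have hSb : S b ≤ 0 := by linarith [(abs_le.mp (hSf b)).2]
    obtain ⟨z, hz, hSz⟩ := (convex_closedBall p δ).isPreconnected.intermediate_value hb ha
      hS.continuousOn ⟨hSb, hSa⟩
    exact ⟨z, hZ ▸ hSz, mem_closedBall'.mp hz⟩
  have hnear : ∀ z ∈ Z, infDist z Γ ≤ ε := by
    intro z hz
    have hSz : S z = 0 := by simpa [hZ] using hz
    have h := abs_le.mp (hSf z)
    rw [hSz, hf] at h
    split_ifs at h <;> linarith [h.1, h.2]
  have hclose : ∀ p ∈ Γ, infDist p Z ≤ δ := by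
    intro p hp
    obtain ⟨z, hz, hpz⟩ := hzero p hp
    exact (infDist_le_dist_of_mem hz).trans hpz
  refine ⟨?_, hnear, hclose, ?_⟩
  · obtain ⟨p, hp⟩ := hΓne
    obtain ⟨z, hz, -⟩ := hzero p hp
    exact ⟨z, hz⟩
  · exact hausdorffDist_le_of_infDist (hδ.le.trans (le_max_right ε δ))
      (fun p hp => (hclose p hp).trans (le_max_right ε δ))
      (fun z hz => (hnear z hz).trans (le_max_left ε δ))
end
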